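/- The space (X, τ) is T4: it is T1 (all singletons are closed) and normal (any two disjoint closed sets are contained in disjoint open sets). -/

import Mathlib

open Set TopologicalSpace

/-- `I` is a σ-ideal of subsets of `X`: it contains `∅`, is closed under taking
subsets and under countable unions. -/
def IsSigmaIdeal {X : Type*} (I : Set (Set X)) : Prop :=
  ∅ ∈ I ∧ (∀ S T : Set X, S ⊆ T → T ∈ I → S ∈ I) ∧
    ∀ f : ℕ → Set X, (∀ n, f n ∈ I) → (⋃ n, f n) ∈ I

/-- The set `B_s` associated to the pattern with (finite) domain `D` and values `s`:
`B_s = ⋂_{α ∈ D} A_α^{s α}` where `A^1 = A` and `A^0 = X \ A`. -/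
def patternSet {X J : Type*} (A : J → Set X) (D : Finset J) (s : J → Bool) : Set X :=
  ⋂ α ∈ D, if s α then A α else (A α)ᶜ

/-- Two patterns are contradictory if they disagree at some common point of their domains. -/
def Contradictory {J : Type*} (p q : Finset J × (J → Bool)) : Prop :=
  ∃ α, α ∈ p.1 ∧ α ∈ q.1 ∧ p.2 α ≠ q.2 α

/-- Independence mod `I`: `B_s ∉ I` for every pattern `s`. -/
def IndependentModI {X J : Type*} (I : Set (Set X)) (A : J → Set X) : Prop :=
  ∀ (D : Finset J) (s : J → Bool), patternSet A D s ∉ I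

/-- Decomposition: every `S ⊆ X` agrees mod `I` with a countable union of `B_s`'s for
pairwise contradictory patterns. -/
def Decomposition {X J : Type*} (I : Set (Set X)) (A : J → Set X) : Prop :=
  ∀ S : Set X, ∃ P : Set (Finset J × (J → Bool)), P.Countable ∧
    P.Pairwise Contradictory ∧ symmDiff S (⋃ p ∈ P, patternSet A p.1 p.2) ∈ I

/-- Separation: disjoint members of `I` are separated by some `A_α`. -/
def SeparatesIdeal {X J : Type*} (I : Set (Set X)) (A : J → Set X) : Prop :=
  ∀ Z ∈ I, ∀ Z' ∈ I, Disjoint Z Z' → ∃ α, Z ⊆ A α ∧ Z' ⊆ (A α)ᶜ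

/-- The topology `τ` generated by the subbasis
`{A_α \ Z : α ∈ J, Z ∈ I} ∪ {(X \ A_α) \ Z : α ∈ J, Z ∈ I}`. -/
def idealTopology {X J : Type*} (I : Set (Set X)) (A : J → Set X) : TopologicalSpace X :=
  TopologicalSpace.generateFrom
    ({U | ∃ α, ∃ Z ∈ I, U = A α \ Z} ∪ {U | ∃ α, ∃ Z ∈ I, U = (A α)ᶜ \ Z})

section IdealTopology

open scoped Topology

variable {X J : Type*} {I : Set (Set X)} {A : J → Set X}

theorem isOpen_idealTopology_sdiff (α : J) {Z : Set X} (hZ : Z ∈ I) :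
    IsOpen[idealTopology I A] (A α \ Z) :=
  isOpen_generateFrom_of_mem (Or.inl ⟨α, Z, hZ, rfl⟩)

theorem isOpen_idealTopology_compl_sdiff (α : J) {Z : Set X} (hZ : Z ∈ I) :
    IsOpen[idealTopology I A] ((A α)ᶜ \ Z) :=
  isOpen_generateFrom_of_mem (Or.inr ⟨α, Z, hZ, rfl⟩)

/-- Members of the ideal are closed. -/
theorem isClosed_idealTopology_of_mem [Nonempty J] {Z : Set X} (hZ : Z ∈ I) :
    IsClosed[idealTopology I A] Z := by
  let _ := idealTopology I A
  obtain ⟨α⟩ := ‹Nonempty J›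
  rw [← isOpen_compl_iff]
  have h : Zᶜ = (A α \ Z) ∪ ((A α)ᶜ \ Z) := by
    rw [← union_sdiff_distrib, union_compl_self, compl_eq_univ_sdiff]
  rw [h]
  exact (isOpen_idealTopology_sdiff α hZ).union (isOpen_idealTopology_compl_sdiff α hZ)

theorem isOpen_idealTopology_patternSet (hI : IsSigmaIdeal I) (D : Finset J) (s : J → Bool) :
    IsOpen[idealTopology I A] (patternSet A D s) := by
  let _ := idealTopology I A
  refine isOpen_biInter_finset fun α _ ↦ ?_
  split_ifs
  · simpa using isOpen_idealTopology_sdiff (A := A) α hI.1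
  · simpa using isOpen_idealTopology_compl_sdiff (A := A) α hI.1

/-- Every set contains an open set whose relative complement belongs to the ideal. -/
theorem exists_isOpen_subset_sdiff_mem [Nonempty J] (hI : IsSigmaIdeal I)
    (hdec : Decomposition I A) (S : Set X) :
    ∃ U ⊆ S, IsOpen[idealTopology I A] U ∧ S \ U ∈ I := by
  let _ := idealTopology I A
  obtain ⟨P, -, -, hP⟩ := hdec S
  refine ⟨⋃ p ∈ P, patternSet A p.1 p.2 ∩ S, iUnion₂_subset fun _ _ ↦ inter_subset_right,
    isOpen_biUnion fun p hp ↦ ?_, hI.2.1 _ _ ?_ hP⟩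
  · have hmem : patternSet A p.1 p.2 \ S ∈ I :=
      hI.2.1 _ _ (fun x hx ↦ Or.inr ⟨mem_biUnion hp hx.1, hx.2⟩) hP
    rw [← sdiff_sdiff_right_self]
    exact (isOpen_idealTopology_patternSet hI p.1 p.2).sdiff (isClosed_idealTopology_of_mem hmem)
  · rw [← iUnion₂_inter, sdiff_inter_self_eq_sdiff]
    exact subset_union_left

end IdealTopology

theorem stmt_9 {X J : Type*} (I : Set (Set X)) (A : J → Set X)
    (hI : IsSigmaIdeal I) (hX : (Set.univ : Set X) ∉ I) (hsing : ∀ x : X, ({x} : Set X) ∈ I)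
    (hind : IndependentModI I A) (hdec : Decomposition I A) (hsep : SeparatesIdeal I A)
    : @T1Space X (idealTopology I A) ∧ @NormalSpace X (idealTopology I A) := by
  let _ := idealTopology I A
  obtain ⟨α₀, -⟩ := hsep ∅ hI.1 ∅ hI.1 (disjoint_empty _)
  have : Nonempty J := ⟨α₀⟩
  refine ⟨⟨fun x ↦ isClosed_idealTopology_of_mem (A := A) (hsing x)⟩, ⟨fun F G hF hG hFG ↦ ?_⟩⟩
  obtain ⟨U, hUF, hU, hFU⟩ := exists_isOpen_subset_sdiff_mem hI hdec F
  obtain ⟨V, hVG, hV, hGV⟩ := exists_isOpen_subset_sdiff_mem hI hdec G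
  obtain ⟨α, hα, hα'⟩ := hsep _ hFU _ hGV (hFG.mono sdiff_subset sdiff_subset)
  have hA : IsOpen (A α) := by simpa using isOpen_idealTopology_sdiff (A := A) α hI.1
  have hA' : IsOpen (A α)ᶜ := by simpa using isOpen_idealTopology_compl_sdiff (A := A) α hI.1
  refine ⟨U ∪ A α \ G, V ∪ (A α)ᶜ \ F, hU.union (hA.sdiff hG), hV.union (hA'.sdiff hF),
    fun x hx ↦ ?_, fun x hx ↦ ?_, ?_⟩
  · by_cases hxU : x ∈ U
    · exact Or.inl hxU
    · exact Or.inr ⟨hα ⟨hx, hxU⟩, disjoint_left.1 hFG hx⟩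
  · by_cases hxV : x ∈ V
    · exact Or.inl hxV
    · exact Or.inr ⟨hα' ⟨hx, hxV⟩, disjoint_right.1 hFG hx⟩
  · rw [disjoint_left]
    rintro x (hxU | hxA) (hxV | hxA')
    · exact disjoint_left.1 hFG (hUF hxU) (hVG hxV)
    · exact hxA'.2 (hUF hxU)
    · exact hxA.2 (hVG hxV)
    · exact hxA'.1 hxA.1
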